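/- arXiv:2202.01005 — 2 statements merged into one kernel-verified Lean document; each statement's English description precedes it below -/
import Mathlib

section
/- Fix γ ∈ (−1,1) and let w_* be one of the two domain walls w_*^±. For every (y,φ) ∈ ℝ², ∫_ℝ |−y·w_*′(x) + φ·(e₁ ∧ w_*(x))|² dx = (y² + φ² + 2γyφ)·2/√(1−γ²) ≥ √(1−γ²)·(y² + φ²). In particular the maps w_*′ and e₁ ∧ w_* are linearly independent in L²(ℝ,ℝ³). -/
open MeasureTheory Filter ENNReal

noncomputable section

abbrev E3 := EuclideanSpace ℝ (Fin 3)

/-- canonical basis vectors of ℝ³ -/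
def e1 : E3 := !₂[1, 0, 0]
def e2 : E3 := !₂[0, 1, 0]
def e3 : E3 := !₂[0, 0, 1]

/-- cross product in ℝ³ -/
def cross3 (a b : E3) : E3 :=
  !₂[a 1 * b 2 - a 2 * b 1, a 2 * b 0 - a 0 * b 2, a 0 * b 1 - a 1 * b 0]

/-- scalar product in ℝ³ -/
def dot3 (a b : E3) : ℝ := a 0 * b 0 + a 1 * b 1 + a 2 * b 2

/-- θ_*(x) = 2 arctan (exp (−√(1−γ²) x)) -/
def thetaStar (γ x : ℝ) : ℝ := 2 * Real.arctan (Real.exp (-Real.sqrt (1 - γ ^ 2) * x))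

/-- φ_*(x) = −γ x -/
def phiStar (γ x : ℝ) : ℝ := -γ * x

/-- the domain walls w_*^± (s = ±1 is the sign) -/
def wStar (γ s x : ℝ) : E3 :=
  !₂[Real.cos (thetaStar γ x),
    s * (Real.sin (thetaStar γ x) * Real.cos (phiStar γ x)),
    s * (Real.sin (thetaStar γ x) * Real.sin (phiStar γ x))]

/-- rotation about the axis e₁ by angle φ -/
def rot (φ : ℝ) (v : E3) : E3 :=
  !₂[v 0, v 1 * Real.cos φ - v 2 * Real.sin φ, v 1 * Real.sin φ + v 2 * Real.cos φ]

/-- the energy gradient δE(m) = −m″ − 2γ e₁ ∧ m′ + m₂e₂ + m₃e₃ -/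
def deltaE (γ : ℝ) (m : ℝ → E3) (x : ℝ) : E3 :=
  -(deriv (deriv m) x) - (2 * γ) • cross3 e1 (deriv m x) + (m x 1) • e2 + (m x 2) • e3

/-- the L² norm of a function on ℝ -/
def L2norm {E : Type*} [NormedAddCommGroup E] (u : ℝ → E) : ℝ :=
  (eLpNorm u 2 volume).toReal

/-- the H¹ norm ‖u‖_{L²} + ‖u′‖_{L²} -/
def H1norm {E : Type*} [NormedAddCommGroup E] [NormedSpace ℝ E] (u : ℝ → E) : ℝ :=
  L2norm u + L2norm (deriv u)

/-- the ℋ¹ seminorm ‖m₂‖_{L²} + ‖m₃‖_{L²} + ‖m′‖_{L²} -/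
def HH1 (m : ℝ → E3) : ℝ :=
  L2norm (fun x => m x 1) + L2norm (fun x => m x 2) + L2norm (deriv m)

/-- the micromagnetic energy E(m) -/
def energy (γ : ℝ) (m : ℝ → E3) : ℝ :=
  (1 / 2) * ∫ x : ℝ,
    (‖deriv m x‖ ^ 2 + 2 * γ * dot3 (deriv m x) (cross3 e1 (m x)) + (1 - (m x 0) ^ 2))

lemma sqrt_pos_aux (γ : ℝ) (hγ : -1 < γ ∧ γ < 1) : 0 < Real.sqrt (1 - γ ^ 2) :=
  Real.sqrt_pos.2 (by nlinarith [hγ.1, hγ.2])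

lemma hasDerivAt_theta (γ x : ℝ) :
    HasDerivAt (thetaStar γ) (-Real.sqrt (1 - γ ^ 2) * Real.sin (thetaStar γ x)) x := by
  unfold thetaStar
  set a := Real.sqrt (1 - γ ^ 2)
  have h1 : HasDerivAt (fun x : ℝ => -a * x) (-a) x := by
    simpa using (hasDerivAt_id x).const_mul (-a)
  have h2 := (h1.exp.arctan).const_mul 2
  refine h2.congr_deriv ?_
  set u := Real.exp (-a * x)
  have hs : Real.sin (Real.arctan u) = u * Real.cos (Real.arctan u) := by
    rw [Real.sin_arctan, Real.cos_arctan]; ring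
  have hc := Real.cos_sq_arctan u
  rw [Real.sin_two_mul, hs, show 2 * (u * Real.cos (Real.arctan u)) * Real.cos (Real.arctan u)
    = 2 * u * Real.cos (Real.arctan u) ^ 2 by ring, hc]
  ring

lemma hasDerivAt_cos_theta (γ x : ℝ) :
    HasDerivAt (fun x => Real.cos (thetaStar γ x))
      (Real.sqrt (1 - γ ^ 2) * Real.sin (thetaStar γ x) ^ 2) x :=
  (hasDerivAt_theta γ x).cos.congr_deriv (by ring)

lemma continuous_theta (γ : ℝ) : Continuous (thetaStar γ) :=
  continuous_iff_continuousAt.2 fun x => (hasDerivAt_theta γ x).continuousAt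

lemma tendsto_top (γ : ℝ) (hγ : -1 < γ ∧ γ < 1) :
    Tendsto (fun x => Real.cos (thetaStar γ x)) atTop (nhds 1) := by
  have ha := sqrt_pos_aux γ hγ
  have h1 : Tendsto (fun x : ℝ => -Real.sqrt (1 - γ ^ 2) * x) atTop atBot :=
    tendsto_id.const_mul_atTop_of_neg (by linarith)
  have h2 := (Real.tendsto_exp_atBot.comp h1)
  have h3 := (((Real.continuous_arctan.tendsto 0).comp h2).const_mul 2)
  have h4 := (Real.continuous_cos.tendsto _).comp h3
  simpa [thetaStar, Function.comp_def] using h4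

lemma tendsto_bot (γ : ℝ) (hγ : -1 < γ ∧ γ < 1) :
    Tendsto (fun x => Real.cos (thetaStar γ x)) atBot (nhds (-1)) := by
  have ha := sqrt_pos_aux γ hγ
  have h1 : Tendsto (fun x : ℝ => -Real.sqrt (1 - γ ^ 2) * x) atBot atTop :=
    tendsto_id.const_mul_atBot_of_neg (by linarith)
  have h2 := (Real.tendsto_exp_atTop.comp h1)
  have h3 := ((Real.tendsto_arctan_atTop.mono_right nhdsWithin_le_nhds).comp h2).const_mul 2
  have h4 := (Real.continuous_cos.tendsto _).comp h3
  rw [show 2 * (Real.pi / 2) = Real.pi by ring, Real.cos_pi] at h4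
  exact h4

lemma integral_sin_sq_theta (γ : ℝ) (hγ : -1 < γ ∧ γ < 1) :
    ∫ x : ℝ, Real.sin (thetaStar γ x) ^ 2 = 2 / Real.sqrt (1 - γ ^ 2) := by
  have ha := sqrt_pos_aux γ hγ
  set a := Real.sqrt (1 - γ ^ 2) with haa
  have hcont : Continuous (fun x => a * Real.sin (thetaStar γ x) ^ 2) :=
    continuous_const.mul ((Real.continuous_sin.comp (continuous_theta γ)).pow 2)
  have hint : Integrable (fun x => a * Real.sin (thetaStar γ x) ^ 2) := by
    refine integrable_of_intervalIntegral_norm_tendsto (ι := ℝ) (l := atTop)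
      (a := fun i => -i) (b := fun i => i) (1 - (-1))
      (fun i => (hcont.integrableOn_Icc).mono_set Set.Ioc_subset_Icc_self)
      tendsto_neg_atTop_atBot tendsto_id ?_
    have hn : ∀ x, ‖a * Real.sin (thetaStar γ x) ^ 2‖ = a * Real.sin (thetaStar γ x) ^ 2 :=
      fun x => Real.norm_of_nonneg (by positivity)
    simp only [hn]
    have : ∀ i : ℝ, ∫ x in (-i)..i, a * Real.sin (thetaStar γ x) ^ 2
        = Real.cos (thetaStar γ i) - Real.cos (thetaStar γ (-i)) := fun i =>
      intervalIntegral.integral_eq_sub_of_hasDerivAt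
        (fun x _ => hasDerivAt_cos_theta γ x) (hcont.intervalIntegrable _ _)
    simp only [this]
    exact (tendsto_top γ hγ).sub ((tendsto_bot γ hγ).comp tendsto_neg_atTop_atBot)
  have h := integral_of_hasDerivAt_of_tendsto (hasDerivAt_cos_theta γ) hint
    (tendsto_bot γ hγ) (tendsto_top γ hγ)
  rw [integral_const_mul] at h
  rw [eq_div_iff ha.ne']
  linarith

lemma deriv_wStar (γ s x : ℝ) : deriv (wStar γ s) x =
    !₂[Real.sqrt (1 - γ ^ 2) * Real.sin (thetaStar γ x) ^ 2,
      s * (-Real.sqrt (1 - γ ^ 2) * Real.sin (thetaStar γ x) * Real.cos (thetaStar γ x)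
        * Real.cos (phiStar γ x) + γ * Real.sin (thetaStar γ x) * Real.sin (phiStar γ x)),
      s * (-Real.sqrt (1 - γ ^ 2) * Real.sin (thetaStar γ x) * Real.cos (thetaStar γ x)
        * Real.sin (phiStar γ x) - γ * Real.sin (thetaStar γ x) * Real.cos (phiStar γ x))] := by
  have hφ : HasDerivAt (phiStar γ) (-γ) x := by
    exact ((hasDerivAt_id x).const_mul (-γ)).congr_deriv (mul_one _)
  have hθ := hasDerivAt_theta γ x
  apply HasDerivAt.deriv
  have hpi : HasDerivAt (fun x => ![Real.cos (thetaStar γ x),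
    s * (Real.sin (thetaStar γ x) * Real.cos (phiStar γ x)),
    s * (Real.sin (thetaStar γ x) * Real.sin (phiStar γ x))]) ![Real.sqrt (1 - γ ^ 2) * Real.sin (thetaStar γ x) ^ 2,
      s * (-Real.sqrt (1 - γ ^ 2) * Real.sin (thetaStar γ x) * Real.cos (thetaStar γ x)
        * Real.cos (phiStar γ x) + γ * Real.sin (thetaStar γ x) * Real.sin (phiStar γ x)),
      s * (-Real.sqrt (1 - γ ^ 2) * Real.sin (thetaStar γ x) * Real.cos (thetaStar γ x)
        * Real.sin (phiStar γ x) - γ * Real.sin (thetaStar γ x) * Real.cos (phiStar γ x))] x := by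
    rw [hasDerivAt_pi]
    intro i
    fin_cases i
    · exact hasDerivAt_cos_theta γ x
    · exact ((hθ.sin.mul hφ.cos).const_mul s).congr_deriv (by simp; left; ring)
    · exact ((hθ.sin.mul hφ.sin).const_mul s).congr_deriv (by simp; left; ring)
  exact (PiLp.hasFDerivAt_toLp (𝕜 := ℝ) 2 _).comp_hasDerivAt x hpi

lemma norm_sq_eq (γ : ℝ) (hγ : -1 < γ ∧ γ < 1) (s : ℝ) (hs : s = 1 ∨ s = -1) (y φ x : ℝ) :
    ‖(-y) • deriv (wStar γ s) x + φ • cross3 e1 (wStar γ s x)‖ ^ 2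
      = (y ^ 2 + φ ^ 2 + 2 * γ * y * φ) * Real.sin (thetaStar γ x) ^ 2 := by
  have ha : Real.sqrt (1 - γ ^ 2) ^ 2 = 1 - γ ^ 2 :=
    Real.sq_sqrt (by nlinarith [hγ.1, hγ.2])
  have hs2 : s ^ 2 = 1 := by rcases hs with rfl | rfl <;> norm_num
  rw [deriv_wStar, EuclideanSpace.norm_sq_eq, Fin.sum_univ_three]
  simp only [cross3, e1, wStar, Real.norm_eq_abs, sq_abs, PiLp.add_apply, PiLp.smul_apply,
    smul_eq_mul, PiLp.toLp_apply, Matrix.cons_val]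
  set a := Real.sqrt (1 - γ ^ 2)
  have h1 := Real.sin_sq_add_cos_sq (thetaStar γ x)
  have h2 := Real.sin_sq_add_cos_sq (phiStar γ x)
  generalize Real.sin (thetaStar γ x) = S at *
  generalize Real.cos (thetaStar γ x) = C at *
  generalize Real.sin (phiStar γ x) = P at *
  generalize Real.cos (phiStar γ x) = R at *
  trans y ^ 2 * a ^ 2 * S ^ 2 * S ^ 2
    + s ^ 2 * (P ^ 2 + R ^ 2) * S ^ 2 * (y ^ 2 * a ^ 2 * C ^ 2 + (y * γ + φ) ^ 2)
  · ring
  · rw [hs2, h2, ha, show C ^ 2 = 1 - S ^ 2 by linarith]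
    ring

/-- the quadratic form generated by ∂ₓw_* and e₁ ∧ w_* in L², and
    the linear independence of these two maps in L². -/
theorem wStar_quadratic_form (γ : ℝ) (hγ : -1 < γ ∧ γ < 1) (s : ℝ) (hs : s = 1 ∨ s = -1) :
    (∀ y φ : ℝ,
      (∫ x : ℝ, ‖(-y) • deriv (wStar γ s) x + φ • cross3 e1 (wStar γ s x)‖ ^ 2)
        = (y ^ 2 + φ ^ 2 + 2 * γ * y * φ) * (2 / Real.sqrt (1 - γ ^ 2)) ∧
      Real.sqrt (1 - γ ^ 2) * (y ^ 2 + φ ^ 2)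
        ≤ (y ^ 2 + φ ^ 2 + 2 * γ * y * φ) * (2 / Real.sqrt (1 - γ ^ 2))) ∧
    (∀ y φ : ℝ,
      (∀ᵐ x : ℝ ∂volume, y • deriv (wStar γ s) x + φ • cross3 e1 (wStar γ s x) = 0) →
      y = 0 ∧ φ = 0) := by
  have ha := sqrt_pos_aux γ hγ
  have ha2 : Real.sqrt (1 - γ ^ 2) ^ 2 = 1 - γ ^ 2 :=
    Real.sq_sqrt (by nlinarith [hγ.1, hγ.2])
  have key : ∀ y φ : ℝ,
      (∫ x : ℝ, ‖(-y) • deriv (wStar γ s) x + φ • cross3 e1 (wStar γ s x)‖ ^ 2)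
        = (y ^ 2 + φ ^ 2 + 2 * γ * y * φ) * (2 / Real.sqrt (1 - γ ^ 2)) ∧
      Real.sqrt (1 - γ ^ 2) * (y ^ 2 + φ ^ 2)
        ≤ (y ^ 2 + φ ^ 2 + 2 * γ * y * φ) * (2 / Real.sqrt (1 - γ ^ 2)) := by
    intro y φ
    constructor
    · simp only [norm_sq_eq γ hγ s hs]
      rw [integral_const_mul, integral_sin_sq_theta γ hγ]
    · rw [← mul_div_assoc, le_div_iff₀ ha]
      have : Real.sqrt (1 - γ ^ 2) * (y ^ 2 + φ ^ 2) * Real.sqrt (1 - γ ^ 2)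
          = (1 - γ ^ 2) * (y ^ 2 + φ ^ 2) := by
        linear_combination (y ^ 2 + φ ^ 2) * ha2
      rw [this]
      nlinarith [sq_nonneg (y + γ * φ), sq_nonneg (φ + γ * y)]
  refine ⟨key, fun y φ h => ?_⟩
  obtain ⟨h1, h2⟩ := key (-y) φ
  have h0 : (∫ x : ℝ, ‖(-(-y)) • deriv (wStar γ s) x + φ • cross3 e1 (wStar γ s x)‖ ^ 2) = 0 := by
    refine integral_eq_zero_of_ae ?_
    filter_upwards [h] with x hx
    rw [neg_neg, hx]
    simp
  rw [← h1, h0] at h2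
  have h3 : (-y) ^ 2 + φ ^ 2 ≤ 0 := by
    by_contra hc
    push Not at hc
    exact absurd h2 (not_le.2 (mul_pos ha hc))
  constructor <;> nlinarith [sq_nonneg y, sq_nonneg φ]
end
end

section
/- Fix γ ∈ (−1,1) and set V(x) = (1−γ²)(cos²θ_*(x) − sin²θ_*(x)). There exists λ₀ > 0 such that: (i) for every continuously differentiable v : ℝ → ℝ with v, v′ ∈ L²: 0 ≤ ∫_ℝ (v′² + V·v²) dx ≤ (1/λ₀)·∫_ℝ (v² + v′²) dx, and ∫_ℝ (v′² + V·v²) dx ≥ 4λ₀·∫_ℝ (v² + v′²) dx − (1/λ₀)·(∫_ℝ v·sin θ_* dx)²; (ii) for every twice continuously differentiable v : ℝ → ℝ with v, v′, v″ ∈ L²: ∫_ℝ (−v″ + V·v)² dx ≥ 4λ₀·∫_ℝ (v² + v′² + v″²) dx − (1/λ₀)·(∫_ℝ v·sin θ_* dx)². -/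
open MeasureTheory Filter ENNReal

noncomputable section

/-- the potential V = (1−γ²)(cos²θ_* − sin²θ_*) of the operator L_γ -/
def Vg (γ x : ℝ) : ℝ :=
  (1 - γ ^ 2) * (Real.cos (thetaStar γ x) ^ 2 - Real.sin (thetaStar γ x) ^ 2)


def sg (x : ℝ) : ℝ := if 0 < x then 1 else -1

lemma sg_sq (x : ℝ) : sg x ^ 2 = 1 := by unfold sg; split_ifs <;> norm_num
lemma sg_abs (x : ℝ) : |sg x| ≤ 1 := by unfold sg; split_ifs <;> norm_num
lemma sg_meas : Measurable sg := Measurable.ite measurableSet_Ioi measurable_const measurable_const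

lemma sg_deriv (F F' : ℝ → ℝ) (hF : ∀ x, HasDerivAt F (F' x) x) (h0 : F 0 = 0) (h0' : F' 0 = 0)
    (x : ℝ) : HasDerivAt (fun y => sg y * F y) (sg x * F' x) x := by
  rcases lt_trichotomy x 0 with h | h | h
  · have e : (fun y => sg y * F y) =ᶠ[nhds x] fun y => (-1) * F y := by
      filter_upwards [Iio_mem_nhds h] with y hy
      have : ¬ (0 < y) := not_lt.2 (le_of_lt hy)
      simp [sg, this]
    have e2 : sg x = -1 := by simp [sg, not_lt.2 h.le]
    rw [e2]
    exact ((hF x).const_mul (-1)).congr_of_eventuallyEq e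
  · subst h
    have h1 := hF 0
    rw [h0', hasDerivAt_iff_isLittleO] at h1
    rw [h0', hasDerivAt_iff_isLittleO]
    refine Asymptotics.IsLittleO.congr' (f₁ := fun y => sg y * F y) (g₁ := fun y => y - 0) ?_
      (Eventually.of_forall fun y => by simp [h0]) (Eventually.of_forall fun y => rfl)
    refine Asymptotics.IsBigO.trans_isLittleO (g := fun y => F y) ?_ ?_
    · refine Asymptotics.IsBigO.of_bound 1 (Eventually.of_forall fun y => ?_)
      rw [norm_mul]
      exact mul_le_mul_of_nonneg_right (sg_abs y) (norm_nonneg _)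
    · simpa [h0] using h1
  · have e : (fun y => sg y * F y) =ᶠ[nhds x] fun y => (1) * F y := by
      filter_upwards [Ioi_mem_nhds h] with y hy
      have : (0 < y) := hy
      simp [sg, this]
    have e2 : sg x = 1 := by simp [sg, h]
    rw [e2]
    exact ((hF x).const_mul 1).congr_of_eventuallyEq e

lemma bddI {f c : ℝ → ℝ} (hf : Integrable f) (hc : Measurable c) (C : ℝ) (h : ∀ x, |c x| ≤ C) :
    Integrable (fun x => c x * f x) :=
  hf.bdd_mul hc.aestronglyMeasurable (Eventually.of_forall h)

lemma bddM {f c : ℝ → ℝ} (hf : MemLp f 2 volume) (hc : Measurable c) (C : ℝ)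
    (h : ∀ x, |c x| ≤ C) : MemLp (fun x => c x * f x) 2 volume := by
  refine MemLp.of_le_mul (c := C) hf
    (hc.aestronglyMeasurable.mul hf.aestronglyMeasurable) (Eventually.of_forall fun x => ?_)
  rw [norm_mul]
  exact mul_le_mul_of_nonneg_right (h x) (norm_nonneg _)

structure WallST (k : ℝ) (s t : ℝ → ℝ) : Prop where
  hk : 0 < k
  hk1 : k ≤ 1
  hs : ∀ x, HasDerivAt s (-k * t x * s x) x
  ht : ∀ x, HasDerivAt t (k * s x ^ 2) x
  hst : ∀ x, s x ^ 2 + t x ^ 2 = 1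
  hpos : ∀ x, 0 ≤ sg x * t x
  hs0 : s 0 = 1

namespace WallST
variable {k : ℝ} {s t : ℝ → ℝ}

lemma t_abs (H : WallST k s t) (x : ℝ) : |t x| ≤ 1 := by
  rw [abs_le]; constructor <;> nlinarith [H.hst x, sq_nonneg (s x)]
lemma s_abs (H : WallST k s t) (x : ℝ) : |s x| ≤ 1 := by
  rw [abs_le]; constructor <;> nlinarith [H.hst x, sq_nonneg (t x)]
lemma t_cont (H : WallST k s t) : Continuous t :=
  continuous_iff_continuousAt.2 fun x => (H.ht x).continuousAt
lemma s_cont (H : WallST k s t) : Continuous s :=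
  continuous_iff_continuousAt.2 fun x => (H.hs x).continuousAt

lemma s_int (H : WallST k s t) : Integrable (fun x => s x ^ 2) := by
  refine integrable_of_intervalIntegral_norm_bounded (μ := volume) (l := atTop)
    (a := fun n : ℝ => -n) (b := fun n : ℝ => n) (2 / k) ?_ tendsto_neg_atTop_atBot tendsto_id ?_
  · intro n
    exact ((H.s_cont.pow 2).continuousOn.integrableOn_Icc).mono_set Set.Ioc_subset_Icc_self
  · refine Eventually.of_forall fun n => ?_
    have h1 : ∫ x in (-n)..n, k * s x ^ 2 = t n - t (-n) :=
      intervalIntegral.integral_eq_sub_of_hasDerivAt (fun x _ => H.ht x)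
        ((continuous_const.mul (H.s_cont.pow 2)).intervalIntegrable _ _)
    rw [intervalIntegral.integral_const_mul] at h1
    have h2 : ∀ x, ‖s x ^ 2‖ = s x ^ 2 := fun x => by
      rw [Real.norm_eq_abs, abs_of_nonneg (sq_nonneg _)]
    simp only [h2]
    rw [le_div_iff₀ H.hk, mul_comm, h1]
    have a1 := abs_le.1 (H.t_abs n)
    have a2 := abs_le.1 (H.t_abs (-n))
    linarith [a1.2, a2.1]

lemma s_memLp (H : WallST k s t) : MemLp s 2 volume :=
  (memLp_two_iff_integrable_sq H.s_cont.aestronglyMeasurable).2 H.s_int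

lemma S_pos (H : WallST k s t) : 0 < ∫ x, s x ^ 2 := by
  refine integral_pos_of_integrable_nonneg_nonzero (x := 0) (H.s_cont.pow 2) H.s_int
    (fun x => sq_nonneg _) ?_
  simp [H.hs0]

/-- The quadratic form is a perfect square. -/
lemma Q_eq (H : WallST k s t) (v v' : ℝ → ℝ) (hv : ∀ x, HasDerivAt v (v' x) x)
    (m : MemLp v 2 volume) (m' : MemLp v' 2 volume) :
    ∫ x, (v' x ^ 2 + k ^ 2 * (t x ^ 2 - s x ^ 2) * v x ^ 2) = ∫ x, (v' x + k * t x * v x) ^ 2 := by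
  have mt := H.t_cont.measurable
  have ms := H.s_cont.measurable
  have i1 := m.integrable_sq
  have i3 : Integrable (fun x => v x * v' x) := m.integrable_mul m'
  have j1 : Integrable (fun x => t x * v x ^ 2) := bddI i1 mt 1 H.t_abs
  have j2 : Integrable (fun x => t x * (v x * v' x)) := bddI i3 mt 1 H.t_abs
  have j3 : Integrable (fun x => s x ^ 2 * v x ^ 2) := bddI i1 (ms.pow_const 2) 1 fun x => by
    rw [abs_le]; constructor <;> nlinarith [H.hst x, sq_nonneg (t x), sq_nonneg (s x)]
  have z : ∫ x, (k * s x ^ 2 * v x ^ 2 + t x * (2 * v x * v' x)) = 0 := by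
    refine integral_eq_zero_of_hasDerivAt_of_integrable (f := fun x => t x * v x ^ 2) ?_ ?_ j1
    · intro x
      have d2 : HasDerivAt (fun y => v y ^ 2) (2 * v x * v' x) x :=
        ((hv x).fun_pow 2).congr_deriv (by norm_num)
      exact (H.ht x).mul d2
    · refine ((j3.const_mul k).add (j2.const_mul 2)).congr (Eventually.of_forall fun x => ?_)
      simp only [Pi.add_apply]; ring
  have iR : Integrable (fun x => (v' x + k * t x * v x) ^ 2) := by
    have : MemLp (fun x => v' x + k * (t x * v x)) 2 volume :=
      m'.add ((bddM m mt 1 H.t_abs).const_mul k)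
    refine this.integrable_sq.congr (Eventually.of_forall fun x => ?_)
    simp only []; ring
  have iZ : Integrable (fun x => k * (k * s x ^ 2 * v x ^ 2 + t x * (2 * v x * v' x))) := by
    refine (((j3.const_mul k).add (j2.const_mul 2)).const_mul k).congr
      (Eventually.of_forall fun x => ?_)
    simp only [Pi.add_apply]; ring
  have : ∀ x, v' x ^ 2 + k ^ 2 * (t x ^ 2 - s x ^ 2) * v x ^ 2 =
      (v' x + k * t x * v x) ^ 2 - k * (k * s x ^ 2 * v x ^ 2 + t x * (2 * v x * v' x)) :=
    fun x => by ring
  simp only [this]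
  rw [integral_sub iR iZ, integral_const_mul, z]; ring

lemma V_abs (H : WallST k s t) (x : ℝ) : |k ^ 2 * (t x ^ 2 - s x ^ 2)| ≤ 1 := by
  have h1 : k ^ 2 ≤ 1 := by nlinarith [H.hk, H.hk1]
  have h2 : |t x ^ 2 - s x ^ 2| ≤ 1 := by
    rw [abs_le]; constructor <;> nlinarith [H.hst x, sq_nonneg (t x), sq_nonneg (s x)]
  rw [abs_mul, abs_of_nonneg (sq_nonneg k)]
  calc _ ≤ 1 * 1 := mul_le_mul h1 h2 (abs_nonneg _) (by norm_num)
    _ = 1 := by norm_num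

lemma V_meas (H : WallST k s t) : Measurable fun x => k ^ 2 * (t x ^ 2 - s x ^ 2) :=
  (continuous_const.mul ((H.t_cont.pow 2).sub (H.s_cont.pow 2))).measurable

lemma pw (k τ e : ℝ) (h0 : 0 ≤ τ) (h1 : τ ≤ 1) (he : e = k / 8) :
    k ^ 2 / 16 ≤ e * k * (1 - τ ^ 2) - 2 * k * e * τ ^ 2 + 4 * k * e * τ - e ^ 2 * (τ - 2) ^ 2 := by
  subst he
  have h : 1 / 16 ≤ (1 - τ ^ 2) / 8 - τ ^ 2 / 4 + τ / 2 - (τ - 2) ^ 2 / 64 := by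
    nlinarith [mul_nonneg h0 (sub_nonneg.2 h1)]
  nlinarith [mul_le_mul_of_nonneg_left h (sq_nonneg k)]

/-- coercivity for functions vanishing at 0 -/
lemma Q_zero (H : WallST k s t) (u u' : ℝ → ℝ) (hu : ∀ x, HasDerivAt u (u' x) x)
    (m : MemLp u 2 volume) (m' : MemLp u' 2 volume) (h0 : u 0 = 0) :
    k ^ 2 / 16 * ∫ x, u x ^ 2 ≤ ∫ x, (u' x ^ 2 + k ^ 2 * (t x ^ 2 - s x ^ 2) * u x ^ 2) := by
  have mt := H.t_cont.measurable
  have ms := H.s_cont.measurable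
  have i1 := m.integrable_sq
  have i2 := m'.integrable_sq
  have i3 : Integrable (fun x => u x * u' x) := m.integrable_mul m'
  have j1 : Integrable (fun x => t x * u x ^ 2) := bddI i1 mt 1 H.t_abs
  have j2 : Integrable (fun x => t x * (u x * u' x)) := bddI i3 mt 1 H.t_abs
  have j3 : Integrable (fun x => s x ^ 2 * u x ^ 2) := bddI i1 (ms.pow_const 2) 1 fun x => by
    rw [abs_le]; constructor <;> nlinarith [H.hst x, sq_nonneg (t x), sq_nonneg (s x)]
  have j4 : Integrable (fun x => sg x * u x ^ 2) := bddI i1 sg_meas 1 sg_abs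
  have j5 : Integrable (fun x => sg x * (u x * u' x)) := bddI i3 sg_meas 1 sg_abs
  have j6 : Integrable (fun x => k ^ 2 * (t x ^ 2 - s x ^ 2) * u x ^ 2) :=
    bddI i1 H.V_meas 1 H.V_abs
  obtain ⟨e, he⟩ : ∃ e, e = k / 8 := ⟨_, rfl⟩
  let P : ℝ → ℝ := fun x => (k + e) * (k * s x ^ 2 * u x ^ 2 + t x * (2 * u x * u' x))
    - 2 * e * (sg x * (2 * u x * u' x))
  have iP : Integrable P := by
    refine ((((j3.const_mul k).add (j2.const_mul 2)).const_mul (k + e)).sub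
      (j5.const_mul (4 * e))).congr (Eventually.of_forall fun x => ?_)
    simp only [Pi.add_apply, Pi.sub_apply, P]; ring
  have z : ∫ x, P x = 0 := by
    refine integral_eq_zero_of_hasDerivAt_of_integrable
      (f := fun x => (k + e) * (t x * u x ^ 2) - 2 * e * (sg x * u x ^ 2)) ?_ iP
      ((j1.const_mul _).sub (j4.const_mul _))
    intro x
    have d2 : ∀ x, HasDerivAt (fun y => u y ^ 2) (2 * u x * u' x) x := fun x =>
      ((hu x).fun_pow 2).congr_deriv (by norm_num)
    have a := ((H.ht x).mul (d2 x)).const_mul (k + e)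
    have b := (sg_deriv _ _ d2 (by simp [h0]) (by simp [h0]) x).const_mul (2 * e)
    exact a.sub b
  have key : ∫ x, k ^ 2 / 16 * u x ^ 2 ≤
      ∫ x, ((u' x ^ 2 + k ^ 2 * (t x ^ 2 - s x ^ 2) * u x ^ 2) + P x) := by
    refine integral_mono (i1.const_mul _) ((i2.add j6).add iP) fun x => ?_
    have hτ : sg x * t x ≤ 1 := by
      have := abs_mul (sg x) (t x)
      have := sg_abs x
      have := H.t_abs x
      calc sg x * t x ≤ |sg x * t x| := le_abs_self _
        _ = |sg x| * |t x| := abs_mul _ _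
        _ ≤ 1 * 1 := by gcongr
        _ = 1 := by norm_num
    have hp := pw k (sg x * t x) e (H.hpos x) hτ he
    have hq := mul_le_mul_of_nonneg_right hp (sq_nonneg (u x))
    have sq := sq_nonneg (u' x + (k * t x + e * (t x - 2 * sg x)) * u x)
    have hs2 : s x ^ 2 = 1 - t x ^ 2 := by linarith [H.hst x]
    have id : (u' x ^ 2 + k ^ 2 * (t x ^ 2 - s x ^ 2) * u x ^ 2) + P x =
      (u' x + (k * t x + e * (t x - 2 * sg x)) * u x) ^ 2 +
      (e * k * (1 - (sg x * t x) ^ 2) - 2 * k * e * (sg x * t x) ^ 2 + 4 * k * e * (sg x * t x)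
        - e ^ 2 * (sg x * t x - 2) ^ 2) * u x ^ 2 := by
      simp only [P]
      have h2 := sg_sq x
      rw [hs2]
      linear_combination ((e * k * t x ^ 2 + 2 * k * e * t x ^ 2 + e^2 * t x ^2 - 4 * e ^ 2) * u x ^ 2) * h2
    simp only []
    rw [id]; linarith
  rw [integral_const_mul, integral_add (f := fun x => u' x ^ 2 + k ^ 2 * (t x ^ 2 - s x ^ 2) * u x ^ 2)
    (i2.add j6) iP, z, add_zero] at key
  exact key

/-- L² bound -/
lemma L2_bound (H : WallST k s t) (v v' : ℝ → ℝ) (hv : ∀ x, HasDerivAt v (v' x) x)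
    (m : MemLp v 2 volume) (m' : MemLp v' 2 volume) :
    ∫ x, v x ^ 2 ≤ 96 / k ^ 2 * (∫ x, (v' x ^ 2 + k ^ 2 * (t x ^ 2 - s x ^ 2) * v x ^ 2))
      + 4 / (∫ x, s x ^ 2) * (∫ x, v x * s x) ^ 2 := by
  have ms := H.s_memLp
  have mts : MemLp (fun x => t x * s x) 2 volume := bddM ms H.t_cont.measurable 1 H.t_abs
  obtain ⟨a, ha⟩ : ∃ a, a = v 0 := ⟨_, rfl⟩
  have mu : MemLp (fun x => v x - a * s x) 2 volume := m.sub (ms.const_mul a)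
  have mu' : MemLp (fun x => v' x - a * (-k * t x * s x)) 2 volume := by
    have : MemLp (fun x => v' x + (a * k) * (t x * s x)) 2 volume := m'.add (mts.const_mul _)
    convert this using 2 with x
    ring
  have hu : ∀ x, HasDerivAt (fun x => v x - a * s x) (v' x - a * (-k * t x * s x)) x :=
    fun x => (hv x).sub ((H.hs x).const_mul a)
  have A := H.Q_zero _ _ hu mu mu' (by simp [H.hs0, ha])
  rw [H.Q_eq _ _ hu mu mu'] at A
  rw [H.Q_eq _ _ hv m m']
  have e : ∀ x, (v' x - a * (-k * t x * s x) + k * t x * (v x - a * s x)) ^ 2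
      = (v' x + k * t x * v x) ^ 2 := fun x => by ring
  simp only [e] at A
  obtain ⟨Q, hQ⟩ : ∃ Q, Q = ∫ x, (v' x + k * t x * v x) ^ 2 := ⟨_, rfl⟩
  rw [← hQ] at A ⊢
  have S0 := H.S_pos
  obtain ⟨S, hS⟩ : ∃ S, S = ∫ x, s x ^ 2 := ⟨_, rfl⟩
  rw [← hS] at S0 ⊢
  obtain ⟨J, hJ⟩ : ∃ J, J = ∫ x, v x * s x := ⟨_, rfl⟩
  rw [← hJ]
  obtain ⟨W, hW⟩ : ∃ W, W = ∫ x, v x ^ 2 := ⟨_, rfl⟩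
  rw [← hW]
  have ivs : Integrable (fun x => v x * s x) := m.integrable_mul ms
  have iv := m.integrable_sq
  have is := H.s_int
  have ex : ∀ b, ∫ x, (v x - b * s x) ^ 2 = W - 2 * b * J + b ^ 2 * S := by
    intro b
    have : ∀ x, (v x - b * s x) ^ 2 = v x ^ 2 - 2 * b * (v x * s x) + b ^ 2 * s x ^ 2 :=
      fun x => by ring
    simp only [this]
    rw [integral_add (f := fun x => v x ^ 2 - 2 * b * (v x * s x)) (iv.sub (ivs.const_mul _)) (is.const_mul _),
      integral_sub iv (ivs.const_mul _), integral_const_mul, integral_const_mul, hW, hJ, hS]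
  rw [ex a] at A
  have k2 : 0 < k ^ 2 := pow_pos H.hk 2
  have A' : W - 2 * a * J + a ^ 2 * S ≤ 16 / k ^ 2 * Q := by
    rw [div_mul_eq_mul_div, le_div_iff₀ k2]; linarith
  -- minimise over the coefficient
  have B : W - J ^ 2 / S ≤ W - 2 * a * J + a ^ 2 * S := by
    have : W - 2 * a * J + a ^ 2 * S - (W - J ^ 2 / S) = (a * S - J) ^ 2 / S := by
      field_simp; ring
    have : 0 ≤ (a * S - J) ^ 2 / S := by positivity
    linarith
  have Q0 : 0 ≤ Q := hQ ▸ integral_nonneg fun x => sq_nonneg _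
  have c1 : 16 / k ^ 2 * Q ≤ 96 / k ^ 2 * Q := by gcongr; norm_num
  have c2 : 4 / S * J ^ 2 = 4 * (J ^ 2 / S) := by ring
  have c3 : 0 ≤ J ^ 2 / S := by positivity
  linarith

end WallST

lemma wall_theta (γ : ℝ) (hγ : -1 < γ ∧ γ < 1) :
    WallST (Real.sqrt (1 - γ ^ 2)) (fun x => Real.sin (thetaStar γ x))
      (fun x => Real.cos (thetaStar γ x)) := by
  have h1 : 0 < 1 - γ ^ 2 := by nlinarith [hγ.1, hγ.2]
  obtain ⟨k, hk⟩ : ∃ k, k = Real.sqrt (1 - γ ^ 2) := ⟨_, rfl⟩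
  have k0 : 0 < k := hk ▸ Real.sqrt_pos.2 h1
  have hsin : ∀ x, Real.sin (thetaStar γ x) =
      2 * Real.exp (-k * x) / (1 + Real.exp (-k * x) ^ 2) := by
    intro x
    have hp : (0 : ℝ) < 1 + Real.exp (-k * x) ^ 2 := by positivity
    have hq := Real.sq_sqrt hp.le
    have hq0 : Real.sqrt (1 + Real.exp (-k * x) ^ 2) ≠ 0 := (Real.sqrt_pos.2 hp).ne'
    unfold thetaStar
    rw [← hk, Real.sin_two_mul, Real.sin_arctan, Real.cos_arctan]
    generalize Real.sqrt (1 + Real.exp (-k * x) ^ 2) = r at hq hq0 ⊢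
    rw [← hq]
    field_simp
  have hcos : ∀ x, Real.cos (thetaStar γ x) =
      (1 - Real.exp (-k * x) ^ 2) / (1 + Real.exp (-k * x) ^ 2) := by
    intro x
    have hp : (0 : ℝ) < 1 + Real.exp (-k * x) ^ 2 := by positivity
    unfold thetaStar
    rw [← hk, Real.cos_two_mul, Real.cos_sq_arctan]
    field_simp
    ring
  have dθ : ∀ x, HasDerivAt (thetaStar γ) (-k * Real.sin (thetaStar γ x)) x := by
    intro x
    have a : HasDerivAt (fun y : ℝ => -k * y) (-k) x := by
      simpa using (hasDerivAt_id x).const_mul (-k)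
    have b := (a.exp.arctan).const_mul 2
    have e : thetaStar γ = fun y => 2 * Real.arctan (Real.exp (-k * y)) := by
      funext y; simp only [thetaStar, hk]
    rw [hsin, e]
    exact b.congr_deriv (by ring)
  rw [← hk]
  refine ⟨k0, ?_, ?_, ?_, ?_, ?_, ?_⟩
  · rw [hk]; exact Real.sqrt_le_one.2 (by nlinarith [sq_nonneg γ])
  · intro x
    exact (dθ x).sin.congr_deriv (by ring)
  · intro x
    exact (dθ x).cos.congr_deriv (by ring)
  · intro x; exact Real.sin_sq_add_cos_sq _
  · intro x
    simp only [hcos, sg]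
    have hp : (0 : ℝ) < 1 + Real.exp (-k * x) ^ 2 := by positivity
    have he := Real.exp_pos (-k * x)
    split_ifs with h
    · have : Real.exp (-k * x) ≤ 1 := Real.exp_le_one_iff.2 (by nlinarith)
      rw [one_mul]
      exact div_nonneg (by nlinarith) hp.le
    · have : 1 ≤ Real.exp (-k * x) := Real.one_le_exp (by nlinarith)
      rw [← mul_div_assoc]
      exact div_nonneg (by nlinarith) hp.le
  · simp only [hsin]; norm_num

/-- coercivity of the Schrödinger operator L_γ = −∂ₓₓ + V up to the
    direction sin θ_*. -/
theorem Lgamma_coercivity (γ : ℝ) (hγ : -1 < γ ∧ γ < 1) :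
    ∃ lam : ℝ, 0 < lam ∧
      (∀ v : ℝ → ℝ, ContDiff ℝ 1 v → MemLp v 2 volume → MemLp (deriv v) 2 volume →
        (0 ≤ ∫ x : ℝ, ((deriv v x) ^ 2 + Vg γ x * (v x) ^ 2)) ∧
        (∫ x : ℝ, ((deriv v x) ^ 2 + Vg γ x * (v x) ^ 2))
          ≤ (1 / lam) * ∫ x : ℝ, ((v x) ^ 2 + (deriv v x) ^ 2) ∧
        4 * lam * (∫ x : ℝ, ((v x) ^ 2 + (deriv v x) ^ 2))
            - (1 / lam) * (∫ x : ℝ, v x * Real.sin (thetaStar γ x)) ^ 2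
          ≤ ∫ x : ℝ, ((deriv v x) ^ 2 + Vg γ x * (v x) ^ 2)) ∧
      (∀ v : ℝ → ℝ, ContDiff ℝ 2 v → MemLp v 2 volume → MemLp (deriv v) 2 volume →
        MemLp (deriv (deriv v)) 2 volume →
        4 * lam * (∫ x : ℝ, ((v x) ^ 2 + (deriv v x) ^ 2 + (deriv (deriv v) x) ^ 2))
            - (1 / lam) * (∫ x : ℝ, v x * Real.sin (thetaStar γ x)) ^ 2
          ≤ ∫ x : ℝ, (-(deriv (deriv v) x) + Vg γ x * v x) ^ 2) := by
  have H := wall_theta γ hγ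
  have h1 : 0 < 1 - γ ^ 2 := by nlinarith [hγ.1, hγ.2]
  obtain ⟨k, hk⟩ : ∃ k, k = Real.sqrt (1 - γ ^ 2) := ⟨_, rfl⟩
  have hk2 : k ^ 2 = 1 - γ ^ 2 := by rw [hk]; exact Real.sq_sqrt h1.le
  rw [← hk] at H
  obtain ⟨s, hs⟩ : ∃ s : ℝ → ℝ, s = fun x => Real.sin (thetaStar γ x) := ⟨_, rfl⟩
  obtain ⟨t, ht⟩ : ∃ t : ℝ → ℝ, t = fun x => Real.cos (thetaStar γ x) := ⟨_, rfl⟩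
  have hV : ∀ x, Vg γ x = k ^ 2 * (t x ^ 2 - s x ^ 2) := by
    intro x; rw [hs, ht, hk2]; rfl
  have hs' : ∀ x, Real.sin (thetaStar γ x) = s x := fun x => by rw [hs]
  rw [← hs, ← ht] at H
  simp only [hV, hs']
  clear hV hs' hs ht
  have k2 : 0 < k ^ 2 := pow_pos H.hk 2
  have S0 := H.S_pos
  have L2 := H.L2_bound
  obtain ⟨a, ha⟩ : ∃ a, a = 96 / k ^ 2 := ⟨_, rfl⟩
  obtain ⟨b, hb⟩ : ∃ b, b = 4 / ∫ x, s x ^ 2 := ⟨_, rfl⟩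
  rw [← ha, ← hb] at L2
  have a0 : 0 < a := by rw [ha]; positivity
  have b0 : 0 < b := by rw [hb]; positivity
  clear ha hb
  -- H¹ bound
  have H1 : ∀ v : ℝ → ℝ, ContDiff ℝ 1 v → MemLp v 2 volume → MemLp (deriv v) 2 volume →
      ∫ x : ℝ, ((v x) ^ 2 + (deriv v x) ^ 2) ≤ (1 + 2 * a) *
        (∫ x, (deriv v x ^ 2 + k ^ 2 * (t x ^ 2 - s x ^ 2) * v x ^ 2))
        + 2 * b * (∫ x, v x * s x) ^ 2 := by
    intro v cv m m'
    have hv : ∀ x, HasDerivAt v (deriv v x) x := fun x =>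
      (cv.differentiable (by norm_num) x).hasDerivAt
    have L := L2 v (deriv v) hv m m'
    have i1 := m.integrable_sq
    have i2 := m'.integrable_sq
    have j6 : Integrable (fun x => k ^ 2 * (t x ^ 2 - s x ^ 2) * v x ^ 2) :=
      bddI i1 H.V_meas 1 H.V_abs
    have M : ∫ x : ℝ, ((v x) ^ 2 + (deriv v x) ^ 2) ≤
        ∫ x, ((deriv v x ^ 2 + k ^ 2 * (t x ^ 2 - s x ^ 2) * v x ^ 2) + 2 * v x ^ 2) := by
      refine integral_mono (i1.add i2) ((i2.add j6).add (i1.const_mul 2)) fun x => ?_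
      have := (abs_le.1 (H.V_abs x)).1
      have := mul_le_mul_of_nonneg_right this (sq_nonneg (v x))
      simp only []
      linarith
    rw [integral_add (f := fun x => deriv v x ^ 2 + k ^ 2 * (t x ^ 2 - s x ^ 2) * v x ^ 2)
      (i2.add j6) (i1.const_mul 2), integral_const_mul] at M
    linarith
  obtain ⟨D, hD⟩ : ∃ D, D = 4 * (1 + 2 * a) ^ 2 + 16 * b + 8 := ⟨_, rfl⟩
  have D0 : 0 < D := by rw [hD]; positivity
  have D8 : 8 ≤ D := by rw [hD]; nlinarith [sq_nonneg (1 + 2 * a)]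
  have Da : 1 + 2 * a ≤ D := by rw [hD]; nlinarith [sq_nonneg (1 + 2 * a)]
  have Db : 2 * b ≤ D := by rw [hD]; nlinarith [sq_nonneg (1 + 2 * a)]
  have fin : ∀ N J R : ℝ, 0 ≤ R → N ≤ D * R + D * J ^ 2 →
      4 * (1 / (4 * D)) * N - 1 / (1 / (4 * D)) * J ^ 2 ≤ R := by
    intro N J R hR h
    rw [one_div_one_div]
    have e : 4 * (1 / (4 * D)) * N = N / D := by field_simp
    have : N / D ≤ R + J ^ 2 := by
      rw [div_le_iff₀ D0]; linarith
    rw [e]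
    nlinarith [sq_nonneg J]
  refine ⟨1 / (4 * D), by positivity, ?_, ?_⟩
  · intro v cv m m'
    have hv : ∀ x, HasDerivAt v (deriv v x) x := fun x =>
      (cv.differentiable (by norm_num) x).hasDerivAt
    have Q0 : 0 ≤ ∫ x, (deriv v x ^ 2 + k ^ 2 * (t x ^ 2 - s x ^ 2) * v x ^ 2) := by
      rw [H.Q_eq v _ hv m m']
      exact integral_nonneg fun x => sq_nonneg _
    have i1 := m.integrable_sq
    have i2 := m'.integrable_sq
    have j6 : Integrable (fun x => k ^ 2 * (t x ^ 2 - s x ^ 2) * v x ^ 2) :=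
      bddI i1 H.V_meas 1 H.V_abs
    refine ⟨Q0, ?_, ?_⟩
    · rw [one_div_one_div, ← integral_const_mul]
      refine integral_mono (i2.add j6) ((i1.add i2).const_mul _) fun x => ?_
      have := (abs_le.1 (H.V_abs x)).2
      have := mul_le_mul_of_nonneg_right this (sq_nonneg (v x))
      simp only []
      nlinarith [sq_nonneg (v x), sq_nonneg (deriv v x)]
    · refine fin _ _ _ Q0 ((H1 v cv m m').trans ?_)
      gcongr
  · intro v cv m m' m''
    have cv1 : ContDiff ℝ 1 v := cv.of_le (by norm_num)
    have hv : ∀ x, HasDerivAt v (deriv v x) x := fun x =>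
      (cv1.differentiable (by norm_num) x).hasDerivAt
    have cd : ContDiff ℝ 1 (deriv v) := by
      have : ContDiff ℝ (1 + 1) v := by simpa [one_add_one_eq_two] using cv
      exact (contDiff_succ_iff_deriv.1 this).2.2
    have hv' : ∀ x, HasDerivAt (deriv v) (deriv (deriv v) x) x := fun x =>
      (cd.differentiable (by norm_num) x).hasDerivAt
    have N1 := H1 v cv1 m m'
    have i1 := m.integrable_sq
    have i2 := m'.integrable_sq
    have i3 := m''.integrable_sq
    have mV : MemLp (fun x => k ^ 2 * (t x ^ 2 - s x ^ 2) * v x) 2 volume :=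
      bddM m H.V_meas 1 H.V_abs
    have mL : MemLp (fun x => -(deriv (deriv v) x) + k ^ 2 * (t x ^ 2 - s x ^ 2) * v x) 2 volume :=
      m''.neg.add mV
    have iL := mL.integrable_sq
    have j6 : Integrable (fun x => k ^ 2 * (t x ^ 2 - s x ^ 2) * v x ^ 2) :=
      bddI i1 H.V_meas 1 H.V_abs
    have iz1 : Integrable (fun x => deriv v x * deriv v x) := m'.integrable_mul m'
    have iz2 : Integrable (fun x => v x * deriv (deriv v) x) := m.integrable_mul m''
    have z : ∫ x, (deriv v x * deriv v x + v x * deriv (deriv v) x) = 0 := by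
      refine integral_eq_zero_of_hasDerivAt_of_integrable (f := fun x => v x * deriv v x) ?_
        (iz1.add iz2) (m.integrable_mul m')
      intro x
      exact (hv x).mul (hv' x)
    obtain ⟨c, hc⟩ : ∃ c, c = 1 + 2 * a := ⟨_, rfl⟩
    rw [← hc] at N1
    have c0 : 0 < c := by rw [hc]; positivity
    -- 2 c Q ≤ N + c² ‖Lv‖²
    have B : ∫ x, (2 * c * (deriv v x ^ 2 + k ^ 2 * (t x ^ 2 - s x ^ 2) * v x ^ 2)) ≤
        ∫ x, (((v x) ^ 2 + (deriv v x) ^ 2) +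
          c ^ 2 * (-(deriv (deriv v) x) + k ^ 2 * (t x ^ 2 - s x ^ 2) * v x) ^ 2
          + 2 * c * (deriv v x * deriv v x + v x * deriv (deriv v) x)) := by
      refine integral_mono ((i2.add j6).const_mul _)
        (((i1.add i2).add (iL.const_mul _)).add ((iz1.add iz2).const_mul _)) fun x => ?_
      simp only []
      nlinarith [sq_nonneg (v x - c * (-(deriv (deriv v) x) + k ^ 2 * (t x ^ 2 - s x ^ 2) * v x)),
        sq_nonneg (deriv v x)]
    rw [integral_const_mul, integral_add (f := fun x => ((v x) ^ 2 + (deriv v x) ^ 2) +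
          c ^ 2 * (-(deriv (deriv v) x) + k ^ 2 * (t x ^ 2 - s x ^ 2) * v x) ^ 2)
        (g := fun x => 2 * c * (deriv v x * deriv v x + v x * deriv (deriv v) x))
        ((i1.add i2).add (iL.const_mul _)) ((iz1.add iz2).const_mul _),
      integral_const_mul, z, integral_add (f := fun x => ((v x) ^ 2 + (deriv v x) ^ 2))
        (i1.add i2) (iL.const_mul _), integral_const_mul] at B
    have C : ∫ x, ((v x) ^ 2 + (deriv v x) ^ 2 + (deriv (deriv v) x) ^ 2) ≤
        ∫ x, (3 * ((v x) ^ 2 + (deriv v x) ^ 2) +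
          2 * (-(deriv (deriv v) x) + k ^ 2 * (t x ^ 2 - s x ^ 2) * v x) ^ 2) := by
      refine integral_mono ((i1.add i2).add i3)
        (((i1.add i2).const_mul _).add (iL.const_mul _)) fun x => ?_
      have hVv : (k ^ 2 * (t x ^ 2 - s x ^ 2)) ^ 2 ≤ 1 := (sq_le_one_iff_abs_le_one _).2 (H.V_abs x)
      have := mul_le_mul_of_nonneg_right hVv (sq_nonneg (v x))
      simp only []
      generalize k ^ 2 * (t x ^ 2 - s x ^ 2) = V at *
      nlinarith [sq_nonneg (deriv (deriv v) x - 2 * (V * v x)), sq_nonneg (deriv v x)]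
    rw [integral_add (f := fun x => 3 * ((v x) ^ 2 + (deriv v x) ^ 2))
        ((i1.add i2).const_mul _) (iL.const_mul _), integral_const_mul, integral_const_mul] at C
    have R0 : 0 ≤ ∫ x, (-(deriv (deriv v) x) + k ^ 2 * (t x ^ 2 - s x ^ 2) * v x) ^ 2 :=
      integral_nonneg fun x => sq_nonneg _
    refine fin _ _ _ R0 (C.trans ?_)
    rw [hD, ← hc]
    nlinarith [sq_nonneg (∫ x, v x * s x), mul_nonneg b0.le (sq_nonneg (∫ x, v x * s x)),
      mul_nonneg (sq_nonneg c) R0, mul_nonneg b0.le R0,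
      mul_nonneg (sq_nonneg c) (sq_nonneg (∫ x, v x * s x))]
end
end
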